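/- Let (Q, ≤, ·) be an abstractly Higman monoidal quasi-order that is a well quasi-order and has the +-property. Then the ideals of Q ordered by inclusion with the operation • form an abstractly Higman structure: for all n, m ∈ ℕ and all prime ideals P₀, …, Pₙ and R₀, …, R_m of Q, P₀•…•Pₙ ⊆ R₀•…•R_m holds if and only if there is a weakly increasing function h : {0,…,n} → {0,…,m} such that Pᵢ ⊆ R_{h(i)} for all i ≤ n and, whenever h⁻¹(j) has more than one element, R_j is idempotent (R_j•R_j = R_j). -/

import Mathlib

/-- `x ≡ y`: the equivalence induced by a quasi-order. -/
def Equi {Q : Type*} (le : Q → Q → Prop) (x y : Q) : Prop := le x y ∧ le y x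

/-- `p` is prime: not equivalent to the neutral element `e`, and
`p ≡ a·b` implies `p ≡ a` or `p ≡ b`. -/
def PrimeEl {Q : Type*} (le : Q → Q → Prop) (mul : Q → Q → Q) (e : Q) (p : Q) : Prop :=
  ¬ Equi le p e ∧ ∀ a b : Q, Equi le p (mul a b) → Equi le p a ∨ Equi le p b

/-- The product of a finite list of elements, with the empty product being `e`. -/
def ProdL {Q : Type*} (mul : Q → Q → Q) (e : Q) : List Q → Q
  | [] => e
  | [a] => a
  | a :: b :: rest => mul a (ProdL mul e (b :: rest))

/-- A monoidal qo is abstractly Higman if products of primes compare exactly via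
weakly increasing maps that only collapse indices at idempotent primes. -/
def AbsHig {Q : Type*} (le : Q → Q → Prop) (mul : Q → Q → Q) (e : Q) : Prop :=
  ∀ (n m : ℕ) (p : Fin (n + 1) → Q) (q : Fin (m + 1) → Q),
    (∀ i, PrimeEl le mul e (p i)) → (∀ j, PrimeEl le mul e (q j)) →
    (le (ProdL mul e (List.ofFn p)) (ProdL mul e (List.ofFn q)) ↔
      ∃ h : Fin (n + 1) → Fin (m + 1), Monotone h ∧ (∀ i, le (p i) (q (h i))) ∧
        ∀ j, (∃ i i', i ≠ i' ∧ h i = j ∧ h i' = j) → Equi le (mul (q j) (q j)) (q j))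

/-- `D` is downward-closed with respect to `le`. -/
def DownCl {Q : Type*} (le : Q → Q → Prop) (D : Set Q) : Prop :=
  ∀ q d, le q d → d ∈ D → q ∈ D

/-- An ideal: a nonempty, downward-closed, upward-directed subset. -/
def IdealSet {Q : Type*} (le : Q → Q → Prop) (S : Set Q) : Prop :=
  S.Nonempty ∧ DownCl le S ∧ ∀ a ∈ S, ∀ b ∈ S, ∃ c ∈ S, le a c ∧ le b c

/-- The product `A•B` of two subsets of a multiplicative quasi-order. -/
def Bullet {Q : Type*} (le : Q → Q → Prop) (mul : Q → Q → Q) (A B : Set Q) : Set Q :=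
  {z : Q | ∃ a ∈ A, ∃ b ∈ B, le z (mul a b)}

/-- The `•`-product of a finite list of subsets, the empty product being the
downward closure of `e`. -/
def SetProdL {Q : Type*} (le : Q → Q → Prop) (mul : Q → Q → Q) (e : Q) :
    List (Set Q) → Set Q
  | [] => {x : Q | le x e}
  | [A] => A
  | A :: B :: rest => Bullet le mul A (SetProdL le mul e (B :: rest))

/-- A prime ideal: an ideal different from the downward closure of `e` such that
`I = J•K` implies `I = J` or `I = K` for all ideals `J`, `K`. -/
def PrimeIdeal {Q : Type*} (le : Q → Q → Prop) (mul : Q → Q → Q) (e : Q)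
    (I : Set Q) : Prop :=
  IdealSet le I ∧ I ≠ {x : Q | le x e} ∧
    ∀ J K : Set Q, IdealSet le J → IdealSet le K → I = Bullet le mul J K →
      I = J ∨ I = K

/-- Higman domination of lists: `L` embeds into `M` along a weakly increasing map with pointwise
`rel`-domination which collapses indices only at entries of `M` satisfying `idem`. -/
inductive HigmanDom {X : Type*} (rel : X → X → Prop) (idem : X → Prop) : List X → List X → Prop
  | nil (M : List X) : HigmanDom rel idem [] M
  | skip {L M : List X} (r : X) (h : HigmanDom rel idem L M) : HigmanDom rel idem L (r :: M)
  | keep {L M : List X} {p r : X} (hpr : rel p r) (h : HigmanDom rel idem L M) :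
      HigmanDom rel idem (p :: L) (r :: M)
  | collapse {L M : List X} {p r : X} (hpr : rel p r) (hr : idem r)
      (h : HigmanDom rel idem L (r :: M)) : HigmanDom rel idem (p :: L) (r :: M)

namespace HigmanDom

variable {X : Type*} {rel : X → X → Prop} {idem : X → Prop}

theorem of_map {n m : ℕ} {p : Fin n → X} {q : Fin m → X} (h : Fin n → Fin m) (hm : Monotone h)
    (hr : ∀ i, rel (p i) (q (h i)))
    (hi : ∀ j, (∃ i i', i ≠ i' ∧ h i = j ∧ h i' = j) → idem (q j)) :
    HigmanDom rel idem (List.ofFn p) (List.ofFn q) := by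
  induction m generalizing n with
  | zero =>
    cases n with
    | zero => simpa using nil _
    | succ n => exact (h 0).elim0
  | succ m ihm =>
    have shift : ∀ {k : ℕ} {p : Fin k → X} (h : Fin k → Fin (m + 1)), Monotone h →
        (∀ i, rel (p i) (q (h i))) →
        (∀ j, (∃ i i', i ≠ i' ∧ h i = j ∧ h i' = j) → idem (q j)) → (∀ i, h i ≠ 0) →
        HigmanDom rel idem (List.ofFn p) (List.ofFn fun j : Fin m => q j.succ) := by
      intro k p h hm hr hi h0
      refine ihm (fun i => (h i).pred (h0 i)) (fun i j hij => ?_) (fun i => ?_) ?_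
      · simpa using hm hij
      · simpa using hr i
      · rintro j ⟨i, i', hne, rfl, h'⟩
        have h'' := congrArg Fin.succ h'
        simp only [Fin.succ_pred] at h''
        simpa using hi (h i) ⟨i, i', hne, rfl, h''⟩
    induction n with
    | zero => simpa using nil _
    | succ n ihn =>
      rw [List.ofFn_succ (f := q)]
      by_cases h0 : h 0 = 0
      · rw [List.ofFn_succ (f := p)]
        have hp : rel (p 0) (q 0) := h0 ▸ hr 0
        have hms : Monotone fun i : Fin n => h i.succ :=
          fun i j hij => hm (Fin.succ_le_succ_iff.2 hij)
        have his : ∀ j, (∃ i i' : Fin n, i ≠ i' ∧ h i.succ = j ∧ h i'.succ = j) → idem (q j) := by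
          rintro j ⟨i, i', hne, h1, h2⟩
          exact hi j ⟨i.succ, i'.succ, by simpa using hne, h1, h2⟩
        by_cases h1 : ∃ i : Fin n, h i.succ = 0
        · obtain ⟨i, h1⟩ := h1
          refine collapse hp (hi 0 ⟨0, i.succ, (Fin.succ_ne_zero i).symm, h0, h1⟩) ?_
          rw [← List.ofFn_succ (f := q)]
          exact ihn (fun i : Fin n => h i.succ) hms (fun i => hr i.succ) his
        · push Not at h1
          exact keep hp (shift (fun i : Fin n => h i.succ) hms (fun i => hr i.succ) his h1)
      · refine skip _ (shift h hm hr hi fun i hi0 => h0 ?_)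
        have := hm (Fin.zero_le i)
        rw [hi0] at this
        exact Fin.le_zero_iff.1 this

theorem exists_map {L M : List X} (H : HigmanDom rel idem L M) :
    ∀ {n m : ℕ} {p : Fin n → X} {q : Fin m → X}, L = List.ofFn p → M = List.ofFn q →
      ∃ h : Fin n → Fin m, Monotone h ∧ (∀ i, rel (p i) (q (h i))) ∧
        ∀ j, (∃ i i', i ≠ i' ∧ h i = j ∧ h i' = j) → idem (q j) := by
  induction H with
  | nil M =>
    intro n m p q hp _
    cases n with
    | zero =>
      exact ⟨Fin.elim0, fun i => i.elim0, fun i => i.elim0, fun _ ⟨i, _⟩ => i.elim0⟩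
    | succ n => simp at hp
  | skip r _ ih =>
    intro n m p q hp hq
    cases m with
    | zero => simp at hq
    | succ m =>
      rw [List.ofFn_succ, List.cons.injEq] at hq
      obtain ⟨h, hm, hr, hi⟩ := ih hp hq.2
      refine ⟨fun i => (h i).succ, fun i j hij => Fin.succ_le_succ_iff.2 (hm hij), hr, ?_⟩
      rintro j ⟨i, i', hne, rfl, h'⟩
      exact hi (h i) ⟨i, i', hne, rfl, Fin.succ_injective _ h'⟩
  | keep hpr _ ih =>
    intro n m p q hp hq
    cases m with
    | zero => simp at hq
    | succ m =>
    cases n with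
    | zero => simp at hp
    | succ n =>
      rw [List.ofFn_succ, List.cons.injEq] at hp hq
      obtain ⟨h, hm, hr, hi⟩ := ih hp.2 hq.2
      refine ⟨Fin.cons 0 fun i => (h i).succ, ?_, ?_, ?_⟩
      · intro i j
        refine Fin.cases ?_ (fun i => ?_) i
        · simp
        · refine Fin.cases ?_ (fun j => ?_) j
          · simp
          · intro hij
            simpa using hm (Fin.succ_le_succ_iff.1 hij)
      · refine Fin.cases ?_ fun i => ?_
        · simpa [← hp.1, ← hq.1] using hpr
        · simpa using hr i
      · rintro j ⟨i, i', hne, rfl, h'⟩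
        induction i using Fin.cases with
        | zero =>
          induction i' using Fin.cases with
          | zero => exact absurd rfl hne
          | succ i' => simp at h'
        | succ i =>
          induction i' using Fin.cases with
          | zero => simp [eq_comm] at h'
          | succ i' =>
            simp only [Fin.cons_succ, Fin.succ_inj] at h' ⊢
            exact hi (h i) ⟨i, i', fun hh => hne (hh ▸ rfl), rfl, h'⟩
  | collapse hpr hidem _ ih =>
    intro n m p q hp hq
    cases m with
    | zero => simp at hq
    | succ m =>
    cases n with
    | zero => simp at hp
    | succ n =>
      rw [List.ofFn_succ, List.cons.injEq] at hp
      obtain ⟨h, hm, hr, hi⟩ := ih hp.2 hq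
      rw [List.ofFn_succ, List.cons.injEq] at hq
      refine ⟨Fin.cons 0 h, ?_, ?_, ?_⟩
      · intro i j
        refine Fin.cases ?_ (fun i => ?_) i
        · simp
        · refine Fin.cases ?_ (fun j => ?_) j
          · simp
          · intro hij
            simpa using hm (Fin.succ_le_succ_iff.1 hij)
      · refine Fin.cases ?_ fun i => ?_
        · simpa [← hp.1, ← hq.1] using hpr
        · simpa using hr i
      · rintro j ⟨i, i', hne, h1, h2⟩
        by_cases hj : j = 0
        · rw [hj, ← hq.1]
          exact hidem
        induction i using Fin.cases with
        | zero => exact absurd h1.symm hj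
        | succ i =>
          induction i' using Fin.cases with
          | zero => exact absurd h2.symm hj
          | succ i' => exact hi j ⟨i, i', fun hh => hne (hh ▸ rfl), h1, h2⟩

theorem ofFn_iff {n m : ℕ} {p : Fin n → X} {q : Fin m → X} :
    HigmanDom rel idem (List.ofFn p) (List.ofFn q) ↔
      ∃ h : Fin n → Fin m, Monotone h ∧ (∀ i, rel (p i) (q (h i))) ∧
        ∀ j, (∃ i i', i ≠ i' ∧ h i = j ∧ h i' = j) → idem (q j) :=
  ⟨fun H => H.exists_map rfl rfl, fun ⟨h, hm, hr, hi⟩ => of_map h hm hr hi⟩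

theorem exists_append {L M : List X} (H : HigmanDom rel idem L M) :
    ∀ M₁ M₂, M = M₁ ++ M₂ →
      ∃ L₁ L₂, L = L₁ ++ L₂ ∧ HigmanDom rel idem L₁ M₁ ∧ HigmanDom rel idem L₂ M₂ := by
  induction H with
  | nil M => exact fun M₁ M₂ _ => ⟨[], [], rfl, nil _, nil _⟩
  | @skip L M r H ih =>
    rintro (_ | ⟨s, M₁⟩) M₂ hM
    · exact ⟨[], L, rfl, nil _, (hM.trans M₂.nil_append) ▸ skip r H⟩
    · rw [List.cons_append, List.cons.injEq] at hM
      obtain ⟨L₁, L₂, rfl, h₁, h₂⟩ := ih M₁ M₂ hM.2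
      exact ⟨L₁, L₂, rfl, skip s h₁, h₂⟩
  | @keep L M p r hpr H ih =>
    rintro (_ | ⟨s, M₁⟩) M₂ hM
    · exact ⟨[], p :: L, rfl, nil _, (hM.trans M₂.nil_append) ▸ keep hpr H⟩
    · rw [List.cons_append, List.cons.injEq] at hM
      obtain ⟨L₁, L₂, rfl, h₁, h₂⟩ := ih M₁ M₂ hM.2
      exact ⟨p :: L₁, L₂, rfl, keep (hM.1 ▸ hpr) h₁, h₂⟩
  | @collapse L M p r hpr hr H ih =>
    rintro (_ | ⟨s, M₁⟩) M₂ hM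
    · exact ⟨[], p :: L, rfl, nil _, (hM.trans M₂.nil_append) ▸ collapse hpr hr H⟩
    · obtain ⟨L₁, L₂, rfl, h₁, h₂⟩ := ih (s :: M₁) M₂ hM
      rw [List.cons_append, List.cons.injEq] at hM
      exact ⟨p :: L₁, L₂, rfl, collapse (hM.1 ▸ hpr) (hM.1 ▸ hr) h₁, h₂⟩

theorem idem_of_two {a b r : X} {L : List X} (H : HigmanDom rel idem (a :: b :: L) [r]) :
    idem r := by
  cases H with
  | skip _ h => cases h
  | keep _ h => cases h
  | collapse _ hr _ => exact hr

end HigmanDom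

/-- The downward-closed subsets of a well quasi-order satisfy the descending chain condition. -/
theorem wellFounded_downCl_ssubset {X : Type*} {r : X → X → Prop} (hr : WellQuasiOrdered r) :
    WellFounded fun S T : {S : Set X // DownCl r S} => S.1 ⊂ T.1 := by
  rw [wellFounded_iff_isEmpty_descending_chain]
  refine ⟨fun ⟨S, hS⟩ => ?_⟩
  have hanti : Antitone fun n => (S n).1 := antitone_nat_of_succ_le fun n => (hS n).1
  choose x hx using fun n => Set.exists_of_ssubset (hS n)
  obtain ⟨i, j, hij, hle⟩ := hr x
  exact (hx i).2 ((S (i + 1)).2 _ _ hle (hanti hij (hx j).1))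

/-- A monoidal quasi-order, as a bundle of the defining properties. -/
structure IsMonoidalQO {Q : Type*} (le : Q → Q → Prop) (mul : Q → Q → Q) (e : Q) : Prop where
  refl : ∀ x, le x x
  trans : ∀ {x y z}, le x y → le y z → le x z
  assoc : ∀ p q r, Equi le (mul (mul p q) r) (mul p (mul q r))
  le_mul_right : ∀ q p, le q (mul q p)
  mono : ∀ {q p q' p'}, le q q' → le p p' → le (mul q p) (mul q' p')
  neut : ∀ q, Equi le (mul e q) q ∧ Equi le (mul q e) q

namespace IsMonoidalQO

variable {Q : Type*} {le : Q → Q → Prop} {mul : Q → Q → Q} {e : Q}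

section Elements

theorem e_le (h : IsMonoidalQO le mul e) (q : Q) : le e q :=
  h.trans (h.le_mul_right e q) (h.neut q).1.1

theorem le_mul_left (h : IsMonoidalQO le mul e) (q p : Q) : le p (mul q p) :=
  h.trans (h.neut p).1.2 (h.mono (h.e_le q) (h.refl p))

theorem mul_le_of_le_e (h : IsMonoidalQO le mul e) {a b : Q} (ha : le a e) : le (mul a b) b :=
  h.trans (h.mono ha (h.refl b)) (h.neut b).1.1

theorem equi_trans (h : IsMonoidalQO le mul e) {x y z : Q} (h₁ : Equi le x y)
    (h₂ : Equi le y z) : Equi le x z :=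
  ⟨h.trans h₁.1 h₂.1, h.trans h₂.2 h₁.2⟩

theorem equi_mul (h : IsMonoidalQO le mul e) {a b a' b' : Q} (h₁ : Equi le a a')
    (h₂ : Equi le b b') : Equi le (mul a b) (mul a' b') :=
  ⟨h.mono h₁.1 h₂.1, h.mono h₁.2 h₂.2⟩

theorem not_prime_le_e (h : IsMonoidalQO le mul e) {p : Q} (hp : PrimeEl le mul e p) :
    ¬ le p e :=
  fun hpe => hp.1 ⟨hpe, h.e_le p⟩

theorem prodL_cons (h : IsMonoidalQO le mul e) (a : Q) (L : List Q) :
    Equi le (ProdL mul e (a :: L)) (mul a (ProdL mul e L)) := by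
  cases L with
  | nil => exact ⟨(h.neut a).2.2, (h.neut a).2.1⟩
  | cons b L => exact ⟨h.refl _, h.refl _⟩

theorem prodL_append (h : IsMonoidalQO le mul e) (L M : List Q) :
    Equi le (ProdL mul e (L ++ M)) (mul (ProdL mul e L) (ProdL mul e M)) := by
  induction L with
  | nil => exact ⟨(h.neut _).1.2, (h.neut _).1.1⟩
  | cons a L ih =>
    have h₁ := h.equi_mul ⟨h.refl a, h.refl a⟩ ih
    have h₂ := h.assoc a (ProdL mul e L) (ProdL mul e M)
    have h₃ := h.equi_mul (h.prodL_cons a L) ⟨h.refl (ProdL mul e M), h.refl _⟩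
    exact h.equi_trans (h.prodL_cons a (L ++ M)) (h.equi_trans h₁ ⟨h.trans h₂.2 h₃.2,
      h.trans h₃.1 h₂.1⟩)

theorem wellFounded_lt (h : IsMonoidalQO le mul e) (hw : WellQuasiOrdered le) :
    WellFounded fun x y => le x y ∧ ¬ le y x := by
  rw [wellFounded_iff_isEmpty_descending_chain]
  refine ⟨fun ⟨f, hf⟩ => ?_⟩
  have hdesc : ∀ i k, le (f (i + k)) (f i) := fun i k => by
    induction k with
    | zero => exact h.refl _
    | succ k ih => exact h.trans (hf (i + k)).1 ih
  obtain ⟨i, j, hij, hle⟩ := hw f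
  obtain ⟨k, rfl⟩ := Nat.exists_eq_add_of_lt hij
  refine (hf i).2 (h.trans hle ?_)
  have := hdesc (i + 1) k
  rwa [Nat.add_right_comm] at this

/-- Every element of a well-founded monoidal quasi-order is a product of primes. -/
theorem exists_prime_factors (h : IsMonoidalQO le mul e) (hw : WellQuasiOrdered le) (x : Q) :
    ∃ L : List Q, (∀ p ∈ L, PrimeEl le mul e p) ∧ Equi le x (ProdL mul e L) := by
  induction x using (h.wellFounded_lt hw).induction with
  | _ x ih =>
    by_cases hx : Equi le x e
    · exact ⟨[], by simp, hx⟩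
    by_cases hp : PrimeEl le mul e x
    · exact ⟨[x], by simpa using hp, h.refl x, h.refl x⟩
    have hab : ∃ a b, Equi le x (mul a b) ∧ ¬ Equi le x a ∧ ¬ Equi le x b := by
      by_contra hcon
      push Not at hcon
      exact hp ⟨hx, fun a b hab => or_iff_not_imp_left.2 (hcon a b hab)⟩
    obtain ⟨a, b, hab, ha, hb⟩ := hab
    have hax := h.trans (h.le_mul_right a b) hab.2
    have hbx := h.trans (h.le_mul_left a b) hab.2
    obtain ⟨La, hLa, ha'⟩ := ih a ⟨hax, fun hxa => ha ⟨hxa, hax⟩⟩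
    obtain ⟨Lb, hLb, hb'⟩ := ih b ⟨hbx, fun hxb => hb ⟨hxb, hbx⟩⟩
    refine ⟨La ++ Lb, fun p hp => (List.mem_append.1 hp).elim (hLa p) (hLb p), ?_⟩
    have h' := h.prodL_append La Lb
    exact h.equi_trans hab (h.equi_trans (h.equi_mul ha' hb') ⟨h'.2, h'.1⟩)

theorem higmanDom_of_prodL_le (h : IsMonoidalQO le mul e) (hH : AbsHig le mul e)
    {L M : List Q} (hL : ∀ p ∈ L, PrimeEl le mul e p) (hM : ∀ p ∈ M, PrimeEl le mul e p)
    (hle : le (ProdL mul e L) (ProdL mul e M)) :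
    HigmanDom le (fun q => Equi le (mul q q) q) L M := by
  cases L with
  | nil => exact .nil _
  | cons a L =>
    cases M with
    | nil =>
      have ha := h.trans (h.trans (h.le_mul_right a _) (h.prodL_cons a L).2) hle
      exact absurd ha (h.not_prime_le_e (hL a (by simp)))
    | cons b M =>
      have h₁ : List.ofFn (fun i : Fin (L.length + 1) => (a :: L).get i) = a :: L :=
        List.ofFn_get (a :: L)
      have h₂ : List.ofFn (fun i : Fin (M.length + 1) => (b :: M).get i) = b :: M :=
        List.ofFn_get (b :: M)
      have := (hH L.length M.length (fun i => (a :: L).get i) (fun i => (b :: M).get i)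
        (fun i => hL _ (List.get_mem _ _)) (fun i => hM _ (List.get_mem _ _))).1
        (by rw [h₁, h₂]; exact hle)
      rw [← HigmanDom.ofFn_iff (rel := le) (idem := fun q => Equi le (mul q q) q), h₁, h₂] at this
      exact this

theorem prodL_le_of_higmanDom (h : IsMonoidalQO le mul e) {L M : List Q}
    (H : HigmanDom le (fun q => Equi le (mul q q) q) L M) :
    le (ProdL mul e L) (ProdL mul e M) := by
  induction H with
  | nil M => exact h.e_le _
  | skip r _ ih => exact h.trans ih (h.trans (h.le_mul_left r _) (h.prodL_cons r _).2)
  | keep hpr _ ih =>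
    exact h.trans (h.prodL_cons _ _).1 (h.trans (h.mono hpr ih) (h.prodL_cons _ _).2)
  | @collapse L M p r hpr hr _ ih =>
    have h₁ := h.mono hpr (h.trans ih (h.prodL_cons r M).1)
    have h₂ := h.trans (h.assoc r r (ProdL mul e M)).2 (h.mono hr.1 (h.refl _))
    exact h.trans (h.prodL_cons _ _).1 (h.trans h₁ (h.trans h₂ (h.prodL_cons _ _).2))

/-- A Levi-type splitting of an inequality between two products. -/
theorem split_mul_le_mul (h : IsMonoidalQO le mul e) (hw : WellQuasiOrdered le)
    (hH : AbsHig le mul e) {p a r b : Q} (hle : le (mul p a) (mul r b)) :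
    (∃ p₁ p₂, le p (mul p₁ p₂) ∧ le p₁ r ∧ le (mul p₂ a) b) ∨
      ∃ a₁ a₂, le a (mul a₁ a₂) ∧ le (mul p a₁) r ∧ le a₂ b := by
  obtain ⟨ps, hps, hp⟩ := h.exists_prime_factors hw p
  obtain ⟨as, has, ha⟩ := h.exists_prime_factors hw a
  obtain ⟨rs, hrs, hr⟩ := h.exists_prime_factors hw r
  obtain ⟨bs, hbs, hb⟩ := h.exists_prime_factors hw b
  have hle' : le (ProdL mul e (ps ++ as)) (ProdL mul e (rs ++ bs)) :=
    h.trans (h.prodL_append ps as).1 (h.trans (h.mono hp.2 ha.2) (h.trans hle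
      (h.trans (h.mono hr.1 hb.1) (h.prodL_append rs bs).2)))
  obtain ⟨L₁, L₂, hL, h₁, h₂⟩ := (h.higmanDom_of_prodL_le hH
    (fun x hx => (List.mem_append.1 hx).elim (hps x) (has x))
    (fun x hx => (List.mem_append.1 hx).elim (hrs x) (hbs x)) hle').exists_append rs bs rfl
  have h₁ := h.trans (h.prodL_le_of_higmanDom h₁) hr.2
  have h₂ := h.trans (h.prodL_le_of_higmanDom h₂) hb.2
  rcases List.append_eq_append_iff.1 hL with ⟨K, rfl, rfl⟩ | ⟨K, rfl, rfl⟩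
  · refine .inr ⟨ProdL mul e K, ProdL mul e L₂, h.trans ha.1 (h.prodL_append K L₂).1, ?_, h₂⟩
    exact h.trans (h.mono hp.1 (h.refl _)) (h.trans (h.prodL_append ps K).2 h₁)
  · refine .inl ⟨ProdL mul e L₁, ProdL mul e K, h.trans hp.1 (h.prodL_append L₁ K).1, h₁, ?_⟩
    exact h.trans (h.mono (h.refl _) ha.1) (h.trans (h.prodL_append K as).2 h₂)

/-- A prime above a product of two nontrivial elements is idempotent. -/
theorem idem_of_mul_le_prime (h : IsMonoidalQO le mul e) (hw : WellQuasiOrdered le)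
    (hH : AbsHig le mul e) {p q r : Q} (hp : ¬ le p e) (hq : ¬ le q e)
    (hr : PrimeEl le mul e r) (hle : le (mul p q) r) : Equi le (mul r r) r := by
  obtain ⟨ps, hps, hp'⟩ := h.exists_prime_factors hw p
  obtain ⟨qs, hqs, hq'⟩ := h.exists_prime_factors hw q
  have hle' : le (ProdL mul e (ps ++ qs)) (ProdL mul e [r]) :=
    h.trans (h.prodL_append ps qs).1 (h.trans (h.mono hp'.2 hq'.2) hle)
  have H := h.higmanDom_of_prodL_le hH
    (fun x hx => (List.mem_append.1 hx).elim (hps x) (hqs x)) (by simpa using hr) hle'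
  match ps, qs, hp', hq', H with
  | [], _, hp', _, _ => exact absurd hp'.1 hp
  | _, [], _, hq', _ => exact absurd hq'.1 hq
  | [a], b :: qs, _, _, H => exact H.idem_of_two
  | a :: b :: ps, c :: qs, _, _, H => exact H.idem_of_two

end Elements

section Ideals

theorem downCl_bullet (h : IsMonoidalQO le mul e) (A B : Set Q) : DownCl le (Bullet le mul A B) :=
  fun _ _ hle ⟨a, ha, b, hb, hab⟩ => ⟨a, ha, b, hb, h.trans hle hab⟩

theorem e_mem (h : IsMonoidalQO le mul e) {I : Set Q} (hI : IdealSet le I) : e ∈ I :=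
  let ⟨x, hx⟩ := hI.1
  hI.2.1 e x (h.e_le x) hx

theorem idealSet_bullet (h : IsMonoidalQO le mul e) {A B : Set Q} (hA : IdealSet le A)
    (hB : IdealSet le B) : IdealSet le (Bullet le mul A B) := by
  refine ⟨⟨e, e, h.e_mem hA, e, h.e_mem hB, h.e_le _⟩, h.downCl_bullet A B, ?_⟩
  rintro x ⟨a, ha, b, hb, hx⟩ y ⟨a', ha', b', hb', hy⟩
  obtain ⟨c, hc, h₁, h₂⟩ := hA.2.2 a ha a' ha'
  obtain ⟨d, hd, h₃, h₄⟩ := hB.2.2 b hb b' hb'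
  exact ⟨mul c d, ⟨c, hc, d, hd, h.refl _⟩, h.trans hx (h.mono h₁ h₃), h.trans hy (h.mono h₂ h₄)⟩

theorem subset_bullet_self (h : IsMonoidalQO le mul e) {I : Set Q} (hI : IdealSet le I) :
    I ⊆ Bullet le mul I I :=
  fun x hx => ⟨x, hx, e, h.e_mem hI, h.le_mul_right x e⟩

theorem exists_not_le_e (h : IsMonoidalQO le mul e) {P : Set Q} (hP : PrimeIdeal le mul e P) :
    ∃ p ∈ P, ¬ le p e := by
  by_contra hcon
  push Not at hcon
  exact hP.2.1 (Set.Subset.antisymm hcon fun x hx => hP.1.2.1 x e hx (h.e_mem hP.1))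

theorem idealSet_setProdL (h : IsMonoidalQO le mul e) :
    ∀ {L : List (Set Q)}, (∀ I ∈ L, IdealSet le I) → IdealSet le (SetProdL le mul e L)
  | [], _ => ⟨⟨e, h.refl e⟩, fun _ _ h₁ h₂ => h.trans h₁ h₂,
      fun _ ha _ hb => ⟨e, h.refl e, ha, hb⟩⟩
  | [I], hL => hL I (by simp)
  | I :: J :: L, hL => h.idealSet_bullet (hL I (by simp))
      (h.idealSet_setProdL fun K hK => hL K (List.mem_cons_of_mem I hK))

theorem setProdL_cons (h : IsMonoidalQO le mul e) {I : Set Q} (hI : DownCl le I)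
    (L : List (Set Q)) :
    SetProdL le mul e (I :: L) = Bullet le mul I (SetProdL le mul e L) := by
  cases L with
  | nil =>
    refine Set.Subset.antisymm (fun x hx => ⟨x, hx, e, h.refl e, h.le_mul_right x e⟩) ?_
    rintro x ⟨a, ha, b, hb, hx⟩
    exact hI x a (h.trans hx (h.trans (h.mono (h.refl a) hb) (h.neut a).2.1)) ha
  | cons J L => rfl

/-- The +-property lifts to ideals: a prime ideal below a product of two downward-closed sets is
below one of the factors. -/
theorem subset_or_subset_of_subset_bullet (h : IsMonoidalQO le mul e) (hw : WellQuasiOrdered le)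
    (hplus : ∀ a b c, le c (mul a b) → ∃ a' b', le a' a ∧ le b' b ∧ Equi le c (mul a' b'))
    {P J K : Set Q} (hP : PrimeIdeal le mul e P) (hJ : DownCl le J) (hK : DownCl le K)
    (hPJK : P ⊆ Bullet le mul J K) : P ⊆ J ∨ P ⊆ K := by
  let r : Q × Q → Q × Q → Prop := fun x y => le x.1 y.1 ∧ le x.2 y.2
  have hr : WellQuasiOrdered r := by
    have : IsPreorder Q le := { refl := h.refl, trans := fun _ _ _ => h.trans }
    exact hw.prod hw
  let cov : Set {S : Set (Q × Q) // DownCl r S} :=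
    {S | ∀ z ∈ P, ∃ s ∈ S.1, le z (mul s.1 s.2)}
  let S₀ : {S : Set (Q × Q) // DownCl r S} :=
    ⟨{s | s.1 ∈ J ∧ s.2 ∈ K ∧ mul s.1 s.2 ∈ P}, fun s t hst ht =>
      ⟨hJ _ _ hst.1 ht.1, hK _ _ hst.2 ht.2.1, hP.1.2.1 _ _ (h.mono hst.1 hst.2) ht.2.2⟩⟩
  have hS₀ : {S | S ∈ cov ∧ S.1 ⊆ S₀.1}.Nonempty := by
    refine ⟨S₀, fun z hz => ?_, subset_rfl⟩
    obtain ⟨a, ha, b, hb, hab⟩ := hPJK hz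
    obtain ⟨a', b', ha', hb', hz'⟩ := hplus a b z hab
    exact ⟨(a', b'), ⟨hJ _ _ ha' ha, hK _ _ hb' hb, hP.1.2.1 _ _ hz'.2 hz⟩, hz'.1⟩
  obtain ⟨S, ⟨hScov, hSS₀⟩, hmin⟩ := (wellFounded_downCl_ssubset hr).has_min _ hS₀
  have hremove : ∀ x ∈ S.1, ∃ z ∈ P, ∀ s ∈ S.1, le z (mul s.1 s.2) → r x s := by
    intro x hx
    by_contra hcon
    push Not at hcon
    refine hmin ⟨{s | s ∈ S.1 ∧ ¬ r x s}, fun s t hst ht => ⟨S.2 s t hst ht.1, fun hxs =>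
      ht.2 ⟨h.trans hxs.1 hst.1, h.trans hxs.2 hst.2⟩⟩⟩ ⟨fun z hz => ?_, ?_⟩ ?_
    · obtain ⟨s, hs, hle, hn⟩ := hcon z hz
      exact ⟨s, ⟨hs, hn⟩, hle⟩
    · exact fun s hs => hSS₀ hs.1
    · exact ⟨fun s hs => hs.1, fun hsub => (hsub hx).2 ⟨h.refl _, h.refl _⟩⟩
  have hdir : ∀ x ∈ S.1, ∀ y ∈ S.1, ∃ s ∈ S.1, r x s ∧ r y s := by
    intro x hx y hy
    obtain ⟨z, hz, hzx⟩ := hremove x hx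
    obtain ⟨w, hw, hwy⟩ := hremove y hy
    obtain ⟨c, hc, hzc, hwc⟩ := hP.1.2.2 z hz w hw
    obtain ⟨s, hs, hcs⟩ := hScov c hc
    exact ⟨s, hs, hzx s hs (h.trans hzc hcs), hwy s hs (h.trans hwc hcs)⟩
  obtain ⟨s₀, hs₀, -⟩ := hScov e (h.e_mem hP.1)
  have hI₁ : IdealSet le {a | ∃ b, (a, b) ∈ S.1} := by
    refine ⟨⟨s₀.1, s₀.2, hs₀⟩, fun q d hqd ⟨b, hb⟩ => ⟨b, S.2 _ _ ⟨hqd, h.refl b⟩ hb⟩, ?_⟩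
    rintro a ⟨b, hb⟩ a' ⟨b', hb'⟩
    obtain ⟨s, hs, h₁, h₂⟩ := hdir _ hb _ hb'
    exact ⟨s.1, ⟨s.2, hs⟩, h₁.1, h₂.1⟩
  have hI₂ : IdealSet le {b | ∃ a, (a, b) ∈ S.1} := by
    refine ⟨⟨s₀.2, s₀.1, hs₀⟩, fun q d hqd ⟨a, ha⟩ => ⟨a, S.2 _ _ ⟨h.refl a, hqd⟩ ha⟩, ?_⟩
    rintro b ⟨a, ha⟩ b' ⟨a', ha'⟩
    obtain ⟨s, hs, h₁, h₂⟩ := hdir _ ha _ ha'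
    exact ⟨s.2, ⟨s.1, hs⟩, h₁.2, h₂.2⟩
  have hPeq : P = Bullet le mul {a | ∃ b, (a, b) ∈ S.1} {b | ∃ a, (a, b) ∈ S.1} := by
    refine Set.Subset.antisymm (fun z hz => ?_) ?_
    · obtain ⟨s, hs, hle⟩ := hScov z hz
      exact ⟨s.1, ⟨s.2, hs⟩, s.2, ⟨s.1, hs⟩, hle⟩
    · rintro z ⟨a, ⟨b', hab'⟩, b, ⟨a', ha'b⟩, hle⟩
      obtain ⟨s, hs, h₁, h₂⟩ := hdir _ hab' _ ha'b
      exact hP.1.2.1 _ _ (h.trans hle (h.mono h₁.1 h₂.2)) (hSS₀ hs).2.2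
  rcases hP.2.2 _ _ hI₁ hI₂ hPeq with heq | heq
  · exact .inl (heq.subset.trans fun a ⟨_, hb⟩ => (hSS₀ hb).1)
  · exact .inr (heq.subset.trans fun b ⟨_, ha⟩ => (hSS₀ ha).2.1)

/-- In a prime ideal that is not idempotent, the prime elements are cofinal. -/
theorem exists_prime_ge (h : IsMonoidalQO le mul e) (hw : WellQuasiOrdered le)
    (hplus : ∀ a b c, le c (mul a b) → ∃ a' b', le a' a ∧ le b' b ∧ Equi le c (mul a' b'))
    {R : Set Q} (hR : PrimeIdeal le mul e R) (hidem : ¬ Bullet le mul R R ⊆ R) {z₀ : Q}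
    (hz₀ : z₀ ∈ R) (hz₀e : ¬ le z₀ e) : ∃ r ∈ R, PrimeEl le mul e r ∧ le z₀ r := by
  by_contra hcon
  push Not at hcon
  have hdown := hR.1.2.1
  have key : ∀ z ∈ R, le z₀ z → ∀ v ∈ R, mul z v ∈ R := by
    intro z hz hz₀z
    let J : Set Q := {x | x ∈ R ∧ ¬ le z x}
    let V : Set Q := {v | mul z v ∈ R}
    have hJ : DownCl le J := fun x y hxy hy => ⟨hdown _ _ hxy hy.1, fun hzx =>
      hy.2 (h.trans hzx hxy)⟩
    have hV : DownCl le V := fun x y hxy hy => hdown _ _ (h.mono (h.refl z) hxy) hy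
    have heJ : e ∈ J := ⟨h.e_mem hR.1, fun hze => hz₀e (h.trans hz₀z hze)⟩
    have heV : e ∈ V := hdown _ _ (h.neut z).2.1 hz
    have hfac : ∀ L : List Q, (∀ p ∈ L, PrimeEl le mul e p) → ∀ u ∈ J,
        mul u (ProdL mul e L) ∈ R →
        mul u (ProdL mul e L) ∈ Bullet le mul J (Bullet le mul J V) := by
      intro L
      induction L with
      | nil =>
        exact fun _ u hu _ =>
          ⟨u, hu, e, ⟨e, heJ, e, heV, h.e_le _⟩, h.refl _⟩
      | cons a L ih =>
        intro hL u hu hmem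
        have hle : Equi le (mul u (ProdL mul e (a :: L))) (mul (mul u a) (ProdL mul e L)) :=
          h.equi_trans (h.equi_mul ⟨h.refl u, h.refl u⟩ (h.prodL_cons a L)) (h.assoc _ _ _).symm
        have hmem' := hdown _ _ hle.2 hmem
        have hua : mul u a ∈ R := hdown _ _ (h.le_mul_right _ _) hmem'
        by_cases hz' : le z (mul u a)
        · have haR : a ∈ R := hdown _ _ (h.le_mul_left u a) hua
          have haJ : a ∈ J := ⟨haR, fun hza => hcon a haR (hL a (by simp)) (h.trans hz₀z hza)⟩
          refine ⟨u, hu, mul a (ProdL mul e L), ⟨a, haJ, ProdL mul e L, ?_, h.refl _⟩,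
            h.mono (h.refl u) (h.prodL_cons a L).1⟩
          exact hdown _ _ (h.mono hz' (h.refl _)) hmem'
        · exact h.downCl_bullet _ _ _ _ hle.1
            (ih (fun p hp => hL p (List.mem_cons_of_mem a hp)) _ ⟨hua, hz'⟩ hmem')
    have hsub : R ⊆ Bullet le mul J (Bullet le mul J V) := by
      intro x hx
      obtain ⟨L, hL, hxL⟩ := h.exists_prime_factors hw x
      have hxL' := h.trans hxL.1 (h.neut _).1.2
      exact h.downCl_bullet _ _ _ _ hxL'
        (hfac L hL e heJ (hdown _ _ (h.trans (h.neut _).1.1 hxL.2) hx))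
    have hRJ : ¬ R ⊆ J := fun hsub => (hsub hz).2 (h.refl z)
    have hRJV := (h.subset_or_subset_of_subset_bullet hw hplus hR hJ
      (h.downCl_bullet J V) hsub).resolve_left hRJ
    exact (h.subset_or_subset_of_subset_bullet hw hplus hR hJ hV hRJV).resolve_left hRJ
  refine hidem ?_
  rintro x ⟨a, ha, b, hb, hx⟩
  obtain ⟨z, hz, h₁, h₂⟩ := hR.1.2.2 z₀ hz₀ a ha
  exact hdown _ _ (h.trans hx (h.mono h₂ (h.refl b))) (key z hz h₁ b hb)

/-- A prime ideal containing a product of two nontrivial elements is idempotent. -/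
theorem bullet_self_eq (h : IsMonoidalQO le mul e) (hw : WellQuasiOrdered le)
    (hplus : ∀ a b c, le c (mul a b) → ∃ a' b', le a' a ∧ le b' b ∧ Equi le c (mul a' b'))
    (hH : AbsHig le mul e) {R : Set Q} (hR : PrimeIdeal le mul e R) {p q : Q}
    (hp : ¬ le p e) (hq : ¬ le q e) (hpq : mul p q ∈ R) : Bullet le mul R R = R := by
  refine Set.Subset.antisymm ?_ (h.subset_bullet_self hR.1)
  by_contra hidem
  refine hidem ?_
  rintro x ⟨a, ha, b, hb, hx⟩
  obtain ⟨c, hc, hac, hbc⟩ := hR.1.2.2 a ha b hb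
  obtain ⟨d, hd, hcd, hpqd⟩ := hR.1.2.2 c hc _ hpq
  obtain ⟨r, hr, hrp, hdr⟩ := h.exists_prime_ge hw hplus hR hidem hd
    fun hde => hp (h.trans (h.le_mul_right p q) (h.trans hpqd hde))
  have hrr := h.idem_of_mul_le_prime hw hH hp hq hrp (h.trans hpqd hdr)
  have hcr := h.trans hcd hdr
  exact hR.1.2.1 _ _ (h.trans hx (h.trans (h.mono (h.trans hac hcr) (h.trans hbc hcr)) hrr.1)) hr

theorem subset_or_bullet_subset (h : IsMonoidalQO le mul e) (hw : WellQuasiOrdered le)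
    (hplus : ∀ a b c, le c (mul a b) → ∃ a' b', le a' a ∧ le b' b ∧ Equi le c (mul a' b'))
    (hH : AbsHig le mul e) {P R A B : Set Q} (hP : PrimeIdeal le mul e P)
    (hR : DownCl le R) (hB : DownCl le B)
    (hsub : Bullet le mul P A ⊆ Bullet le mul R B) : P ⊆ R ∨ Bullet le mul P A ⊆ B := by
  by_cases hPR : P ⊆ R
  · exact .inl hPR
  refine .inr ?_
  rintro x ⟨p, hp, a, ha, hx⟩
  obtain ⟨p₀, hp₀, hp₀R⟩ := Set.not_subset.1 hPR
  have hT : DownCl le {t | mul t a ∈ B} := fun s t hst ht =>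
    hB _ _ (h.mono hst (h.refl a)) ht
  have hPT : P ⊆ Bullet le mul R {t | mul t a ∈ B} := by
    intro y hy
    obtain ⟨z, hz, hyz, hpz⟩ := hP.1.2.2 y hy p₀ hp₀
    obtain ⟨r, hr, b, hb, hle⟩ := hsub ⟨z, hz, a, ha, h.refl _⟩
    rcases h.split_mul_le_mul hw hH hle with ⟨p₁, p₂, hz', h₁, h₂⟩ | ⟨a₁, a₂, -, h₁, -⟩
    · exact ⟨p₁, hR _ _ h₁ hr, p₂, hB _ _ h₂ hb, h.trans hyz hz'⟩
    · exact absurd (hR _ _ (h.trans hpz (h.trans (h.le_mul_right z a₁) h₁)) hr) hp₀R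
  have hPT' := (h.subset_or_subset_of_subset_bullet hw hplus hP hR hT hPT).resolve_left hPR
  exact hB _ _ hx (hPT' hp)

theorem subset_of_bullet_subset_bullet (h : IsMonoidalQO le mul e) (hw : WellQuasiOrdered le)
    (hplus : ∀ a b c, le c (mul a b) → ∃ a' b', le a' a ∧ le b' b ∧ Equi le c (mul a' b'))
    (hH : AbsHig le mul e) {P R A B : Set Q} (hP : PrimeIdeal le mul e P)
    (hR : PrimeIdeal le mul e R) (hB : DownCl le B) (hidem : Bullet le mul R R ≠ R)
    (hsub : Bullet le mul P A ⊆ Bullet le mul R B) : A ⊆ B := by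
  intro a ha
  obtain ⟨p, hp, hpe⟩ := h.exists_not_le_e hP
  obtain ⟨r, hr, b, hb, hle⟩ := hsub ⟨p, hp, a, ha, h.refl _⟩
  rcases h.split_mul_le_mul hw hH hle with ⟨p₁, p₂, -, -, h₂⟩ | ⟨a₁, a₂, ha', h₁, h₂⟩
  · exact hB _ _ (h.trans (h.le_mul_left p₂ a) h₂) hb
  · have ha₁ : le a₁ e := by
      by_contra hn
      exact hidem (h.bullet_self_eq hw hplus hH hR hpe hn (hR.1.2.1 _ _ h₁ hr))
    exact hB _ _ (h.trans ha' (h.trans (h.mul_le_of_le_e ha₁) h₂)) hb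

theorem higmanDom_of_setProdL_subset (h : IsMonoidalQO le mul e) (hw : WellQuasiOrdered le)
    (hplus : ∀ a b c, le c (mul a b) → ∃ a' b', le a' a ∧ le b' b ∧ Equi le c (mul a' b'))
    (hH : AbsHig le mul e) {Rs : List (Set Q)} (hRs : ∀ R ∈ Rs, PrimeIdeal le mul e R)
    {Ps : List (Set Q)} (hPs : ∀ P ∈ Ps, PrimeIdeal le mul e P)
    (hsub : SetProdL le mul e Ps ⊆ SetProdL le mul e Rs) :
    HigmanDom (· ⊆ ·) (fun R => Bullet le mul R R = R) Ps Rs := by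
  induction Rs generalizing Ps with
  | nil =>
    cases Ps with
    | nil => exact .nil _
    | cons P Ps =>
      have hP := hPs P (by simp)
      have hA := h.idealSet_setProdL fun I hI => (hPs I (List.mem_cons_of_mem P hI)).1
      rw [h.setProdL_cons hP.1.2.1] at hsub
      obtain ⟨p, hp, hpe⟩ := h.exists_not_le_e hP
      exact absurd (hsub ⟨p, hp, e, h.e_mem hA, h.le_mul_right p e⟩) hpe
  | cons R Rs ihR =>
    have hR := hRs R (by simp)
    have hRs' : ∀ S ∈ Rs, PrimeIdeal le mul e S := fun S hS => hRs S (List.mem_cons_of_mem R hS)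
    have hB := h.idealSet_setProdL fun I hI => (hRs' I hI).1
    induction Ps with
    | nil => exact .nil _
    | cons P Ps ihP =>
      have hP := hPs P (by simp)
      have hPs' : ∀ S ∈ Ps, PrimeIdeal le mul e S :=
        fun S hS => hPs S (List.mem_cons_of_mem P hS)
      have hsub' := hsub
      rw [h.setProdL_cons hP.1.2.1, h.setProdL_cons hR.1.2.1] at hsub'
      rcases h.subset_or_bullet_subset hw hplus hH hP hR.1.2.1 hB.2.1 hsub' with hPR | hPB
      · by_cases hidem : Bullet le mul R R = R
        · refine .collapse hPR hidem (ihP hPs' ?_)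
          rw [h.setProdL_cons hP.1.2.1] at hsub
          exact fun a ha => hsub ⟨e, h.e_mem hP.1, a, ha, h.le_mul_left e a⟩
        · exact .keep hPR (ihR hRs' hPs'
            (h.subset_of_bullet_subset_bullet hw hplus hH hP hR hB.2.1 hidem hsub'))
      · refine .skip R (ihR hRs' hPs ?_)
        rwa [h.setProdL_cons hP.1.2.1]

theorem setProdL_subset_of_higmanDom (h : IsMonoidalQO le mul e) {Ps Rs : List (Set Q)}
    (H : HigmanDom (· ⊆ ·) (fun R => Bullet le mul R R = R) Ps Rs)
    (hPs : ∀ P ∈ Ps, IdealSet le P) (hRs : ∀ R ∈ Rs, IdealSet le R) :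
    SetProdL le mul e Ps ⊆ SetProdL le mul e Rs := by
  induction H with
  | nil M =>
    have hM := h.idealSet_setProdL hRs
    exact fun x hx => hM.2.1 x e hx (h.e_mem hM)
  | skip r _ ih =>
    rw [List.forall_mem_cons] at hRs
    rw [h.setProdL_cons hRs.1.2.1]
    exact fun x hx => ⟨e, h.e_mem hRs.1, x, ih hPs hRs.2 hx, h.le_mul_left e x⟩
  | keep hpr _ ih =>
    rw [List.forall_mem_cons] at hPs hRs
    rw [h.setProdL_cons hPs.1.2.1, h.setProdL_cons hRs.1.2.1]
    rintro x ⟨a, ha, b, hb, hx⟩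
    exact ⟨a, hpr ha, b, ih hPs.2 hRs.2 hb, hx⟩
  | collapse hpr hr _ ih =>
    have hRs' := hRs
    rw [List.forall_mem_cons] at hPs hRs
    have ih' := ih hPs.2 hRs'
    rw [h.setProdL_cons hRs.1.2.1] at ih'
    rw [h.setProdL_cons hPs.1.2.1, h.setProdL_cons hRs.1.2.1]
    rintro x ⟨a, ha, b, hb, hx⟩
    obtain ⟨c, hc, d, hd, hbd⟩ := ih' hb
    refine ⟨mul a c, hr.subset ⟨a, hpr ha, c, hc, h.refl _⟩, d, hd, ?_⟩
    exact h.trans hx (h.trans (h.mono (h.refl a) hbd) (h.assoc a c d).2)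

end Ideals

end IsMonoidalQO

/-- If `Q` is an abstractly Higman monoidal wqo with the +-property, then the ideals
of `Q`, ordered by inclusion with the operation `•`, are abstractly Higman. -/
theorem stmt13 {Q : Type*} (le : Q → Q → Prop) (mul : Q → Q → Q) (e : Q)
    (hrefl : ∀ x, le x x)
    (htrans : ∀ x y z, le x y → le y z → le x z)
    (hassoc : ∀ p q r, Equi le (mul (mul p q) r) (mul p (mul q r)))
    (hincr : ∀ q p, le q (mul q p))
    (hmono : ∀ q p q' p', le q q' → le p p' → le (mul q p) (mul q' p'))
    (hneut : ∀ q, Equi le (mul e q) q ∧ Equi le (mul q e) q)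
    (hwqo : ∀ f : ℕ → Q, ∃ i j, i < j ∧ le (f i) (f j))
    (hplus : ∀ a b c, le c (mul a b) →
      ∃ a' b', le a' a ∧ le b' b ∧ Equi le c (mul a' b'))
    (hhig : AbsHig le mul e) :
    ∀ (n m : ℕ) (P : Fin (n + 1) → Set Q) (R : Fin (m + 1) → Set Q),
      (∀ i, PrimeIdeal le mul e (P i)) → (∀ j, PrimeIdeal le mul e (R j)) →
      (SetProdL le mul e (List.ofFn P) ⊆ SetProdL le mul e (List.ofFn R) ↔
        ∃ h : Fin (n + 1) → Fin (m + 1), Monotone h ∧ (∀ i, P i ⊆ R (h i)) ∧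
          ∀ j, (∃ i i', i ≠ i' ∧ h i = j ∧ h i' = j) →
            Bullet le mul (R j) (R j) = R j) := by
  intro n m P R hP hR
  have h : IsMonoidalQO le mul e :=
    ⟨hrefl, fun {x y z} => htrans x y z, hassoc, hincr, fun {q p q' p'} => hmono q p q' p', hneut⟩
  have hP' : ∀ I ∈ List.ofFn P, PrimeIdeal le mul e I := List.forall_mem_ofFn_iff.2 hP
  have hR' : ∀ I ∈ List.ofFn R, PrimeIdeal le mul e I := List.forall_mem_ofFn_iff.2 hR
  rw [← HigmanDom.ofFn_iff (rel := (· ⊆ ·)) (idem := fun I : Set Q => Bullet le mul I I = I)]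
  exact ⟨h.higmanDom_of_setProdL_subset hwqo hplus hhig hR' hP', fun H =>
    h.setProdL_subset_of_higmanDom H (fun I hI => (hP' I hI).1) fun I hI => (hR' I hI).1⟩
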